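/- Space Lipschitz estimate: Let L, ρ, μ, T > 0, let G ∈ C^∞(ℝ) with G ≥ 0, and let u : [0,T]×[0,L] → ℝ be smooth (C² in t and C⁴ in x, with continuous mixed derivative ∂_t∂²ₓu) satisfying ρ∂²_t u = −μ∂⁴ₓu − G'(u) on [0,T]×(0,L) and the boundary conditions ∂²ₓu(t,0) = ∂²ₓu(t,L) = ∂³ₓu(t,0) = ∂³ₓu(t,L) = 0 for all t ∈ [0,T]. Then there is a constant C, depending only on ρ, μ, L, T, on ‖u(0,·)‖_{L²(0,L)} and on the initial energy E(0) = ∫₀^L ((ρ(∂_t u(0,x))² + μ(∂²ₓu(0,x))²)/2 + G(u(0,x))) dx, such that |∂ₓu(t,x)| ≤ C for all (t,x) ∈ [0,T]×[0,L]. -/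

import Mathlib

open MeasureTheory Filter Set intervalIntegral Real

/-- The integral over a compact interval of a function continuous on a rectangle depends
continuously on the parameter. -/
theorem continuousOn_intervalIntegral_of_continuousOn_rectangle {f : ℝ → ℝ → ℝ} {a b c d : ℝ}
    (hcd : c ≤ d)
    (hf : ContinuousOn (fun p : ℝ × ℝ => f p.1 p.2) (Icc a b ×ˢ Icc c d)) :
    ContinuousOn (fun t => ∫ y in c..d, f t y) (Icc a b) := by
  obtain ⟨K, hK⟩ := (isCompact_Icc.prod isCompact_Icc).exists_bound_of_continuousOn hf
  intro t ht
  refine intervalIntegral.continuousWithinAt_of_dominated_interval (bound := fun _ => K) ?_ ?_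
    intervalIntegrable_const ?_
  · filter_upwards [self_mem_nhdsWithin] with s hs
    rw [uIoc_of_le hcd]
    exact ((ContinuousOn.uncurry_left s hs hf).mono Ioc_subset_Icc_self).aestronglyMeasurable
      measurableSet_Ioc
  · filter_upwards [self_mem_nhdsWithin] with s hs
    refine ae_of_all _ fun y hy => ?_
    rw [uIoc_of_le hcd] at hy
    exact hK (s, y) ⟨hs, Ioc_subset_Icc_self hy⟩
  · refine ae_of_all _ fun y hy => ?_
    rw [uIoc_of_le hcd] at hy
    exact ContinuousOn.uncurry_right y (Ioc_subset_Icc_self hy) hf t ht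

/-- Differentiation under the integral sign for a function that is continuous, together with
its derivative in the parameter, on a rectangle. -/
theorem hasDerivAt_intervalIntegral_of_continuousOn_rectangle {f f' : ℝ → ℝ → ℝ} {a b c d : ℝ}
    (hcd : c ≤ d)
    (hf : ContinuousOn (fun p : ℝ × ℝ => f p.1 p.2) (Icc a b ×ˢ Icc c d))
    (hf' : ContinuousOn (fun p : ℝ × ℝ => f' p.1 p.2) (Icc a b ×ˢ Icc c d))
    (hderiv : ∀ y ∈ Icc c d, ∀ t ∈ Icc a b, HasDerivAt (fun τ => f τ y) (f' t y) t)
    {t : ℝ} (ht : t ∈ Ioo a b) :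
    HasDerivAt (fun τ => ∫ y in c..d, f τ y) (∫ y in c..d, f' t y) t := by
  obtain ⟨K, hK⟩ := (isCompact_Icc.prod isCompact_Icc).exists_bound_of_continuousOn hf'
  have hmeas : ∀ {g : ℝ → ℝ → ℝ},
      ContinuousOn (fun p : ℝ × ℝ => g p.1 p.2) (Icc a b ×ˢ Icc c d) → ∀ s ∈ Icc a b,
      AEStronglyMeasurable (g s) (volume.restrict (uIoc c d)) := fun hg s hs => by
    rw [uIoc_of_le hcd]
    exact ((ContinuousOn.uncurry_left s hs hg).mono Ioc_subset_Icc_self).aestronglyMeasurable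
      measurableSet_Ioc
  have hnhds : Ioo a b ∈ nhds t := Ioo_mem_nhds ht.1 ht.2
  have ht' := Ioo_subset_Icc_self ht
  refine (intervalIntegral.hasDerivAt_integral_of_dominated_loc_of_deriv_le
    (bound := fun _ => K) hnhds ?_ ?_ (hmeas hf' t ht') ?_ intervalIntegrable_const ?_).2
  · filter_upwards [hnhds] with s hs
    exact hmeas hf s (Ioo_subset_Icc_self hs)
  · exact (ContinuousOn.uncurry_left t ht' hf).intervalIntegrable_of_Icc hcd
  · refine ae_of_all _ fun y hy s hs => ?_
    rw [uIoc_of_le hcd] at hy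
    exact hK (s, y) ⟨Ioo_subset_Icc_self hs, Ioc_subset_Icc_self hy⟩
  · refine ae_of_all _ fun y hy s hs => ?_
    rw [uIoc_of_le hcd] at hy
    exact hderiv y (Ioc_subset_Icc_self hy) s (Ioo_subset_Icc_self hs)

/-- A function that is differentiable in the parameter, with derivative continuous on a rectangle,
and continuous in the other variable is jointly continuous on the rectangle. -/
theorem continuousOn_rectangle_of_hasDerivAt {f f' : ℝ → ℝ → ℝ} {a b c d : ℝ}
    (hf : ∀ t ∈ Icc a b, ContinuousOn (f t) (Icc c d))
    (hf' : ContinuousOn (fun p : ℝ × ℝ => f' p.1 p.2) (Icc a b ×ˢ Icc c d))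
    (hderiv : ∀ y ∈ Icc c d, ∀ t ∈ Icc a b, HasDerivAt (fun τ => f τ y) (f' t y) t) :
    ContinuousOn (fun p : ℝ × ℝ => f p.1 p.2) (Icc a b ×ˢ Icc c d) := by
  obtain ⟨K, hK⟩ := (isCompact_Icc.prod isCompact_Icc).exists_bound_of_continuousOn hf'
  refine continuousOn_prod_of_continuousOn_lipschitzOnWith _ K.toNNReal hf fun y hy => ?_
  refine (convex_Icc a b).lipschitzOnWith_of_nnnorm_hasDerivWithin_le
    (fun t ht => (hderiv y hy t ht).hasDerivWithinAt) fun t ht => ?_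
  rw [← NNReal.coe_le_coe, coe_nnnorm]
  exact (hK (t, y) ⟨ht, hy⟩).trans (Real.le_coe_toNNReal K)

/-- The oscillation of a function on an interval is controlled by the square integral of its
derivative. -/
theorem sub_le_of_integral_sq_deriv {L : ℝ} {g g' : ℝ → ℝ}
    (hg : ∀ x ∈ Icc 0 L, HasDerivAt g (g' x) x) (hg' : ContinuousOn g' (Icc 0 L))
    {x y : ℝ} (hx : x ∈ Icc 0 L) (hy : y ∈ Icc 0 L) :
    |g x - g y| ≤ (L + ∫ z in (0 : ℝ)..L, g' z ^ 2) / 2 := by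
  have hL : 0 ≤ L := hx.1.trans hx.2
  wlog hyx : y ≤ x generalizing x y
  · rw [abs_sub_comm]
    exact this hy hx (le_of_not_ge hyx)
  have hsub : Icc y x ⊆ Icc 0 L := Icc_subset_Icc hy.1 hx.2
  have hint : ∀ {h : ℝ → ℝ}, ContinuousOn h (Icc 0 L) → IntervalIntegrable h volume 0 L :=
    fun hh => hh.intervalIntegrable_of_Icc hL
  have hftc : ∫ z in y..x, g' z = g x - g y := by
    refine intervalIntegral.integral_eq_sub_of_hasDerivAt (fun z hz => hg z (hsub ?_))
      ((hg'.mono hsub).intervalIntegrable_of_Icc hyx)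
    rwa [uIcc_of_le hyx] at hz
  calc |g x - g y| = |∫ z in y..x, g' z| := by rw [hftc]
    _ ≤ ∫ z in y..x, |g' z| := intervalIntegral.abs_integral_le_integral_abs hyx
    _ ≤ ∫ z in (0 : ℝ)..L, |g' z| :=
        intervalIntegral.integral_mono_interval hy.1 hyx hx.2
          (ae_of_all _ fun z => abs_nonneg _) (hint hg'.abs)
    _ ≤ ∫ z in (0 : ℝ)..L, (1 + g' z ^ 2) / 2 := by
        refine intervalIntegral.integral_mono_on hL (hint hg'.abs) (hint (by fun_prop))
          fun z _ => ?_
        nlinarith [sq_nonneg (|g' z| - 1), sq_abs (g' z)]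
    _ = (L + ∫ z in (0 : ℝ)..L, g' z ^ 2) / 2 := by
        rw [intervalIntegral.integral_div, intervalIntegral.integral_add
          intervalIntegrable_const (hint (by fun_prop))]
        simp

/-- One-sided bound on the derivative of a function in terms of its `L²` norm and the oscillation
of its derivative. -/
theorem deriv_le_of_integral_sq {L B : ℝ} {f g : ℝ → ℝ} (hL : 0 ≤ L)
    (hf : ∀ x ∈ Icc 0 L, HasDerivAt f (g x) x) (hg : ContinuousOn g (Icc 0 L)) {x : ℝ}
    (hB : ∀ y ∈ Icc 0 L, g x - g y ≤ B) :
    g x * (L ^ 3 / 6) ≤ B * (L ^ 3 / 6) + ((∫ y in (0 : ℝ)..L, f y ^ 2) + L ^ 3) / 2 := by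
  have hfc : ContinuousOn f (Icc 0 L) := fun y hy => (hf y hy).continuousAt.continuousWithinAt
  have hint : ∀ {h : ℝ → ℝ}, ContinuousOn h (Icc 0 L) → IntervalIntegrable h volume 0 L :=
    fun hh => hh.intervalIntegrable_of_Icc hL
  have hw : ∫ y in (0 : ℝ)..L, y * (L - y) = L ^ 3 / 6 := by
    simp only [mul_sub, ← sq]
    rw [intervalIntegral.integral_sub (hint (by fun_prop)) (hint (by fun_prop)),
      intervalIntegral.integral_mul_const, integral_id, integral_pow]
    norm_num
    ring
  have hzero : ∫ y in (0 : ℝ)..L, (g y * (y * (L - y)) + f y * (L - 2 * y)) = 0 := by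
    rw [intervalIntegral.integral_eq_sub_of_hasDerivAt (f := fun y => f y * (y * (L - y)))
      (fun y hy => ?_) (hint (by fun_prop))]
    · simp
    · rw [uIcc_of_le hL] at hy
      have h1 : HasDerivAt (fun y : ℝ => y * (L - y)) (1 * (L - y) + y * (0 - 1)) y :=
        (hasDerivAt_id y).mul ((hasDerivAt_const y L).sub (hasDerivAt_id y))
      exact ((hf y hy).mul h1).congr_deriv (by ring)
  calc g x * (L ^ 3 / 6) = ∫ y in (0 : ℝ)..L, g x * (y * (L - y)) := by
        rw [intervalIntegral.integral_const_mul, hw]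
    _ ≤ ∫ y in (0 : ℝ)..L, ((g y * (y * (L - y)) + f y * (L - 2 * y)) + (B * (y * (L - y)) +
          (f y ^ 2 + L ^ 2) / 2)) := by
        refine intervalIntegral.integral_mono_on hL (hint (by fun_prop)) (hint (by fun_prop))
          fun y hy => ?_
        have h1 := mul_le_mul_of_nonneg_right (hB y hy) (mul_nonneg hy.1 (sub_nonneg.2 hy.2))
        have h2 := mul_nonneg hy.1 (sub_nonneg.2 hy.2)
        nlinarith [sq_nonneg (f y + (L - 2 * y))]
    _ = B * (L ^ 3 / 6) + ((∫ y in (0 : ℝ)..L, f y ^ 2) + L ^ 3) / 2 := by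
        rw [intervalIntegral.integral_add (hint (by fun_prop)) (hint (by fun_prop)), hzero,
          intervalIntegral.integral_add (hint (by fun_prop)) (hint (by fun_prop)),
          intervalIntegral.integral_const_mul, hw, intervalIntegral.integral_div,
          intervalIntegral.integral_add (hint (by fun_prop)) (hint (by fun_prop))]
        simp
        ring

/-- Interpolation bound for the derivative `g` of `f` by the `L²` norms of `f` and of its second
derivative. -/
theorem abs_deriv_le_of_integral_sq {L A M : ℝ} {f g h : ℝ → ℝ} (hL : 0 < L)
    (hf : ∀ x ∈ Icc 0 L, HasDerivAt f (g x) x) (hg : ∀ x ∈ Icc 0 L, HasDerivAt g (h x) x)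
    (hh : ContinuousOn h (Icc 0 L)) (hM : ∫ y in (0 : ℝ)..L, f y ^ 2 ≤ M)
    (hA : ∫ y in (0 : ℝ)..L, h y ^ 2 ≤ A) {x : ℝ} (hx : x ∈ Icc 0 L) :
    |g x| ≤ (L + A) / 2 + 3 * (M + L ^ 3) / L ^ 3 := by
  have hgc : ContinuousOn g (Icc 0 L) := fun y hy => (hg y hy).continuousAt.continuousWithinAt
  have hosc : ∀ y ∈ Icc 0 L, |g x - g y| ≤ (L + A) / 2 := fun y hy =>
    (sub_le_of_integral_sq_deriv hg hh hx hy).trans (by linarith)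
  have h1 := deriv_le_of_integral_sq hL.le hf hgc fun y hy => (abs_le.1 (hosc y hy)).2
  have h2 := deriv_le_of_integral_sq (f := fun y => -f y) (g := fun y => -g y) (x := x)
    hL.le (fun y hy => (hf y hy).neg) hgc.neg
    fun y hy => show -g x - -g y ≤ (L + A) / 2 by linarith [(abs_le.1 (hosc y hy)).1]
  simp only [neg_sq] at h2
  have hL3 : 0 < L ^ 3 := by positivity
  have key : |g x| * (L ^ 3 / 6) ≤ (L + A) / 2 * (L ^ 3 / 6) + (M + L ^ 3) / 2 := by
    rcases abs_cases (g x) with ⟨h, _⟩ | ⟨h, _⟩ <;> rw [h] <;> linarith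
  have heq : (L + A) / 2 * (L ^ 3 / 6) + (M + L ^ 3) / 2 =
      ((L + A) / 2 + 3 * (M + L ^ 3) / L ^ 3) * (L ^ 3 / 6) := by
    field_simp
    ring
  rw [heq] at key
  exact le_of_mul_le_mul_right key (by positivity)

/-- Two integrations by parts against a function `h` which vanishes, together with its derivative,
at both ends of the interval. -/
theorem integral_mul_deriv_deriv_eq {L : ℝ} {f f' f'' h h' h'' : ℝ → ℝ} (hL : 0 ≤ L)
    (hf : ∀ x ∈ Icc 0 L, HasDerivAt f (f' x) x) (hf' : ∀ x ∈ Icc 0 L, HasDerivAt f' (f'' x) x)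
    (hh : ∀ x ∈ Icc 0 L, HasDerivAt h (h' x) x) (hh' : ∀ x ∈ Icc 0 L, HasDerivAt h' (h'' x) x)
    (hf'' : ContinuousOn f'' (Icc 0 L)) (hh'' : ContinuousOn h'' (Icc 0 L))
    (h0 : h 0 = 0) (h1 : h L = 0) (h0' : h' 0 = 0) (h1' : h' L = 0) :
    ∫ y in (0 : ℝ)..L, f y * h'' y = ∫ y in (0 : ℝ)..L, f'' y * h y := by
  have hint : ∀ {h : ℝ → ℝ}, ContinuousOn h (Icc 0 L) → IntervalIntegrable h volume 0 L :=
    fun hh => hh.intervalIntegrable_of_Icc hL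
  have hc : ∀ {p q : ℝ → ℝ}, (∀ x ∈ Icc 0 L, HasDerivAt p (q x) x) → ContinuousOn p (Icc 0 L) :=
    fun hp y hy => (hp y hy).continuousAt.continuousWithinAt
  have hfc := hc hf
  have hhc := hc hh
  have hzero : ∫ y in (0 : ℝ)..L, (f y * h'' y - f'' y * h y) = 0 := by
    rw [intervalIntegral.integral_eq_sub_of_hasDerivAt (f := fun y => f y * h' y - f' y * h y)
      (fun y hy => ?_) (hint (by fun_prop))]
    · simp [h0, h1, h0', h1']
    · rw [uIcc_of_le hL] at hy
      exact (((hf y hy).mul (hh' y hy)).sub ((hf' y hy).mul (hh y hy))).congr_deriv (by ring)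
  rw [intervalIntegral.integral_sub (hint (by fun_prop)) (hint (by fun_prop))] at hzero
  exact sub_eq_zero.1 hzero

/-- **Space Lipschitz estimate.**  Let `L, ρ, μ, T > 0`.  There is a constant `C`, depending only on
`ρ, μ, L, T`, on the initial `L²` norm `∫₀ᴸ u(0,x)² dx` and on the initial energy
`E(0) = ∫₀ᴸ ((ρ (∂ₜu(0,x))² + μ (∂ₓ²u(0,x))²)/2 + G(u(0,x))) dx`, such that any classical
solution `u` of the beam equation `ρ ∂ₜ²u = -μ ∂ₓ⁴u - G'(u)` (with `G` smooth and
nonnegative) with free-end boundary conditions satisfies `|∂ₓu(t,x)| ≤ C` on `[0,T] × [0,L]`.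
The constant is quantified as a function `C` of the initial `L²` norm and the initial
energy, chosen after `ρ, μ, L, T` but before `G` and `u`. -/
theorem space_lipschitz_estimate
    (L ρ μ T : ℝ) (hL : 0 < L) (hρ : 0 < ρ) (hμ : 0 < μ) (hT : 0 < T) :
    ∃ C : ℝ → ℝ → ℝ,
      ∀ (G : ℝ → ℝ), ContDiff ℝ (⊤ : ℕ∞) G → (∀ s, 0 ≤ G s) →
      ∀ (u ut utt ux uxx uxxx uxxxx utxx : ℝ → ℝ → ℝ),
      -- time derivatives
      (∀ x ∈ Icc 0 L, ∀ t ∈ Icc 0 T, HasDerivAt (fun τ => u τ x) (ut t x) t) →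
      (∀ x ∈ Icc 0 L, ∀ t ∈ Icc 0 T, HasDerivAt (fun τ => ut τ x) (utt t x) t) →
      -- space derivatives
      (∀ t ∈ Icc 0 T, ∀ x ∈ Icc 0 L, HasDerivAt (fun y => u t y) (ux t x) x) →
      (∀ t ∈ Icc 0 T, ∀ x ∈ Icc 0 L, HasDerivAt (fun y => ux t y) (uxx t x) x) →
      (∀ t ∈ Icc 0 T, ∀ x ∈ Icc 0 L, HasDerivAt (fun y => uxx t y) (uxxx t x) x) →
      (∀ t ∈ Icc 0 T, ∀ x ∈ Icc 0 L, HasDerivAt (fun y => uxxx t y) (uxxxx t x) x) →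
      -- mixed derivative ∂ₜ∂ₓ²u
      (∀ x ∈ Icc 0 L, ∀ t ∈ Icc 0 T, HasDerivAt (fun τ => uxx τ x) (utxx t x) t) →
      -- continuity of the derivatives on [0,T] × [0,L]
      (∀ v ∈ ({ut, utt, ux, uxx, uxxx, uxxxx, utxx} : Set (ℝ → ℝ → ℝ)),
        ContinuousOn (fun p : ℝ × ℝ => v p.1 p.2) (Icc 0 T ×ˢ Icc 0 L)) →
      -- the PDE ρ ∂ₜ²u = -μ ∂ₓ⁴u - G'(u) on [0,T] × (0,L)
      (∀ t ∈ Icc 0 T, ∀ x ∈ Ioo 0 L,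
        ρ * utt t x = -μ * uxxxx t x - deriv G (u t x)) →
      -- free-end boundary conditions
      (∀ t ∈ Icc 0 T,
        uxx t 0 = 0 ∧ uxx t L = 0 ∧ uxxx t 0 = 0 ∧ uxxx t L = 0) →
      ∀ t ∈ Icc 0 T, ∀ x ∈ Icc 0 L,
        |ux t x| ≤ C (∫ y in (0:ℝ)..L, (u 0 y) ^ 2)
          (∫ y in (0:ℝ)..L, ((ρ * (ut 0 y) ^ 2 + μ * (uxx 0 y) ^ 2) / 2 + G (u 0 y))) := by
  refine ⟨fun M₀ E₀ => (L + 2 * E₀ / μ) / 2 +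
    3 * ((exp T * (M₀ + 2 * E₀ / ρ)) + L ^ 3) / L ^ 3, ?_⟩
  intro G hG hG0 u ut utt ux uxx uxxx uxxxx utxx hut hutt hux huxx huxxx huxxxx hutxx hcont
    hpde hbc t ht x hx
  simp only [mem_insert_iff, mem_singleton_iff, forall_eq_or_imp, forall_eq] at hcont
  obtain ⟨cut, cutt, cux, cuxx, cuxxx, cuxxxx, cutxx⟩ := hcont
  have hGc : Continuous G := hG.continuous
  have hG'c : Continuous (deriv G) := hG.continuous_deriv (by norm_num)
  have hGd : ∀ s, HasDerivAt G (deriv G s) s := fun s =>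
    (hG.differentiable (by simp) s).hasDerivAt
  have cu : ContinuousOn (fun p : ℝ × ℝ => u p.1 p.2) (Icc 0 T ×ˢ Icc 0 L) :=
    continuousOn_rectangle_of_hasDerivAt
      (fun t ht y hy => (hux t ht y hy).continuousAt.continuousWithinAt) cut hut
  have hsl : ∀ {f : ℝ → ℝ → ℝ},
      ContinuousOn (fun p : ℝ × ℝ => f p.1 p.2) (Icc 0 T ×ˢ Icc 0 L) →
      ∀ t ∈ Icc 0 T, ContinuousOn (f t) (Icc 0 L) :=
    fun hf t ht => ContinuousOn.uncurry_left t ht hf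
  have hint : ∀ {h : ℝ → ℝ}, ContinuousOn h (Icc 0 L) → IntervalIntegrable h volume 0 L :=
    fun hh => hh.intervalIntegrable_of_Icc hL.le
  have h0T : (0 : ℝ) ∈ Icc 0 T := ⟨le_rfl, hT.le⟩
  -- integration by parts in space of the elastic power
  have hparts : ∀ s ∈ Ioo 0 T,
      ∫ y in (0 : ℝ)..L, ut s y * uxxxx s y = ∫ y in (0 : ℝ)..L, utxx s y * uxx s y := by
    intro s hs
    have hs' := Ioo_subset_Icc_self hs
    have cxx : ContinuousOn (fun p : ℝ × ℝ => uxx s p.2) (Icc 0 T ×ˢ Icc 0 L) :=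
      (hsl cuxx s hs').comp continuousOn_snd fun p hp => hp.2
    have cxxxx : ContinuousOn (fun p : ℝ × ℝ => uxxxx s p.2) (Icc 0 T ×ˢ Icc 0 L) :=
      (hsl cuxxxx s hs').comp continuousOn_snd fun p hp => hp.2
    have h1 := hasDerivAt_intervalIntegral_of_continuousOn_rectangle
      (f := fun τ y => u τ y * uxxxx s y) (f' := fun τ y => ut τ y * uxxxx s y) hL.le
      (cu.mul cxxxx) (cut.mul cxxxx) (fun y hy τ hτ => (hut y hy τ hτ).mul_const _) hs
    have h2 := hasDerivAt_intervalIntegral_of_continuousOn_rectangle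
      (f := fun τ y => uxx τ y * uxx s y) (f' := fun τ y => utxx τ y * uxx s y) hL.le
      (cuxx.mul cxx) (cutxx.mul cxx) (fun y hy τ hτ => (hutxx y hy τ hτ).mul_const _) hs
    obtain ⟨b1, b2, b3, b4⟩ := hbc s hs'
    refine h1.unique (h2.congr_of_eventuallyEq ?_)
    filter_upwards [Ioo_mem_nhds hs.1 hs.2] with τ hτ
    have hτ' := Ioo_subset_Icc_self hτ
    exact integral_mul_deriv_deriv_eq hL.le (hux τ hτ') (huxx τ hτ') (huxxx s hs')
      (huxxxx s hs') (hsl cuxx τ hτ') (hsl cuxxxx s hs') b1 b2 b3 b4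
  -- the energy does not increase
  set E : ℝ → ℝ := fun s =>
    ∫ y in (0 : ℝ)..L, ((ρ * ut s y ^ 2 + μ * uxx s y ^ 2) / 2 + G (u s y))
  have cE : ContinuousOn
      (fun p : ℝ × ℝ => (ρ * ut p.1 p.2 ^ 2 + μ * uxx p.1 p.2 ^ 2) / 2 + G (u p.1 p.2))
      (Icc 0 T ×ˢ Icc 0 L) := by
    fun_prop
  have hEd : ∀ s ∈ Ioo 0 T, HasDerivAt E 0 s := by
    intro s hs
    have hs' := Ioo_subset_Icc_self hs
    have h1 := hasDerivAt_intervalIntegral_of_continuousOn_rectangle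
      (f := fun τ y => (ρ * ut τ y ^ 2 + μ * uxx τ y ^ 2) / 2 + G (u τ y))
      (f' := fun τ y => ρ * (ut τ y * utt τ y) + μ * (utxx τ y * uxx τ y) +
        deriv G (u τ y) * ut τ y) hL.le cE (by fun_prop)
      (fun y hy τ hτ => by
        refine HasDerivAt.congr_deriv (((((hutt y hy τ hτ).pow 2).const_mul ρ).add
          (((hutxx y hy τ hτ).pow 2).const_mul μ)).div_const 2 |>.add
          ((hGd (u τ y)).comp τ (hut y hy τ hτ))) ?_
        push_cast
        ring) hs
    convert h1 using 1
    have cut' := hsl cut s hs'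
    have cuxx' := hsl cuxx s hs'
    have cuxxxx' := hsl cuxxxx s hs'
    have cutxx' := hsl cutxx s hs'
    have h2 : ∫ y in (0 : ℝ)..L, (ρ * (ut s y * utt s y) + μ * (utxx s y * uxx s y) +
          deriv G (u s y) * ut s y) =
        ∫ y in (0 : ℝ)..L, (μ * (utxx s y * uxx s y) - μ * (ut s y * uxxxx s y)) := by
      simp only [intervalIntegral.integral_of_le hL.le, integral_Ioc_eq_integral_Ioo]
      refine setIntegral_congr_fun measurableSet_Ioo fun y hy => ?_
      linear_combination ut s y * hpde s hs' y hy
    rw [h2, intervalIntegral.integral_sub (hint (by fun_prop)) (hint (by fun_prop)),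
      intervalIntegral.integral_const_mul, intervalIntegral.integral_const_mul, hparts s hs,
      sub_self]
  have hanti : ∀ {F F' : ℝ → ℝ}, ContinuousOn F (Icc 0 T) →
      (∀ s ∈ Ioo 0 T, HasDerivAt F (F' s) s) → (∀ s ∈ Ioo 0 T, F' s ≤ 0) →
      ∀ s ∈ Icc 0 T, F s ≤ F 0 := by
    intro F F' hFc hF hF' s hs
    refine antitoneOn_of_deriv_nonpos (convex_Icc 0 T) hFc ?_ ?_ h0T hs hs.1
    · rw [interior_Icc]
      exact fun r hr => (hF r hr).differentiableAt.differentiableWithinAt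
    · rw [interior_Icc]
      intro r hr
      rw [(hF r hr).deriv]
      exact hF' r hr
  have hE0 : ∀ s ∈ Icc 0 T, E s ≤ E 0 :=
    hanti (continuousOn_intervalIntegral_of_continuousOn_rectangle hL.le cE) hEd
      fun _ _ => le_rfl
  have hkin : ∀ s ∈ Icc 0 T, ∫ y in (0 : ℝ)..L, ut s y ^ 2 ≤ 2 * E 0 / ρ := by
    intro s hs
    have c1 := hsl cut s hs
    have c2 := hsl cuxx s hs
    have c3 := hsl cu s hs
    rw [le_div_iff₀ hρ]
    have h : ∫ y in (0 : ℝ)..L, ρ / 2 * ut s y ^ 2 ≤ E s :=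
      intervalIntegral.integral_mono_on hL.le (hint (by fun_prop)) (hint (by fun_prop))
        fun y _ => by nlinarith [hG0 (u s y), mul_nonneg hμ.le (sq_nonneg (uxx s y))]
    rw [intervalIntegral.integral_const_mul] at h
    linarith [hE0 s hs]
  have hela : ∀ s ∈ Icc 0 T, ∫ y in (0 : ℝ)..L, uxx s y ^ 2 ≤ 2 * E 0 / μ := by
    intro s hs
    have c1 := hsl cut s hs
    have c2 := hsl cuxx s hs
    have c3 := hsl cu s hs
    rw [le_div_iff₀ hμ]
    have h : ∫ y in (0 : ℝ)..L, μ / 2 * uxx s y ^ 2 ≤ E s :=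
      intervalIntegral.integral_mono_on hL.le (hint (by fun_prop)) (hint (by fun_prop))
        fun y _ => by nlinarith [hG0 (u s y), mul_nonneg hρ.le (sq_nonneg (ut s y))]
    rw [intervalIntegral.integral_const_mul] at h
    linarith [hE0 s hs]
  -- Grönwall estimate for the `L²` norm
  have hK0 : 0 ≤ 2 * E 0 / ρ :=
    (intervalIntegral.integral_nonneg hL.le fun y _ => sq_nonneg (ut 0 y)).trans (hkin 0 h0T)
  have cu2 : ContinuousOn (fun p : ℝ × ℝ => u p.1 p.2 ^ 2) (Icc 0 T ×ˢ Icc 0 L) := by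
    fun_prop
  have hM : ∫ y in (0 : ℝ)..L, u t y ^ 2 ≤
      exp T * ((∫ y in (0 : ℝ)..L, u 0 y ^ 2) + 2 * E 0 / ρ) := by
    set M : ℝ → ℝ := fun s => ∫ y in (0 : ℝ)..L, u s y ^ 2
    have cM : ContinuousOn M (Icc 0 T) :=
      continuousOn_intervalIntegral_of_continuousOn_rectangle hL.le cu2
    have hMd : ∀ s ∈ Ioo 0 T, HasDerivAt M (∫ y in (0 : ℝ)..L, 2 * (u s y * ut s y)) s :=
      fun s hs => hasDerivAt_intervalIntegral_of_continuousOn_rectangle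
        (f := fun τ y => u τ y ^ 2) (f' := fun τ y => 2 * (u τ y * ut τ y)) hL.le cu2
        (by fun_prop) (fun y hy τ hτ => by
          refine ((hut y hy τ hτ).pow 2).congr_deriv ?_
          push_cast
          ring) hs
    have hgron := hanti (F := fun s => exp (-s) * (M s + 2 * E 0 / ρ)) (by fun_prop)
      (fun s hs => ((hasDerivAt_id s).neg.exp).mul ((hMd s hs).add_const _)) (fun s hs => by
        have hs' := Ioo_subset_Icc_self hs
        have c1 := hsl cut s hs'
        have c3 := hsl cu s hs'
        have h : ∫ y in (0 : ℝ)..L, 2 * (u s y * ut s y) ≤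
            ∫ y in (0 : ℝ)..L, (u s y ^ 2 + ut s y ^ 2) :=
          intervalIntegral.integral_mono_on hL.le (hint (by fun_prop)) (hint (by fun_prop))
            fun y _ => by nlinarith [sq_nonneg (u s y - ut s y)]
        rw [intervalIntegral.integral_add (hint (by fun_prop)) (hint (by fun_prop))] at h
        have h' := mul_le_mul_of_nonneg_left (h.trans (add_le_add_right (hkin s hs') (M s)))
          (exp_pos (-s)).le
        change exp (-s) * -1 * (M s + 2 * E 0 / ρ) +
          exp (-s) * ∫ y in (0 : ℝ)..L, 2 * (u s y * ut s y) ≤ 0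
        linarith) t ht
    simp only [neg_zero, exp_zero, one_mul] at hgron
    have hpos : 0 ≤ M 0 + 2 * E 0 / ρ :=
      add_nonneg (intervalIntegral.integral_nonneg hL.le fun y _ => sq_nonneg _) hK0
    calc M t ≤ M t + 2 * E 0 / ρ := le_add_of_nonneg_right hK0
      _ = exp t * (exp (-t) * (M t + 2 * E 0 / ρ)) := by
          rw [← mul_assoc, ← exp_add, add_neg_cancel, exp_zero, one_mul]
      _ ≤ exp t * (M 0 + 2 * E 0 / ρ) := by gcongr
      _ ≤ exp T * (M 0 + 2 * E 0 / ρ) := by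
          gcongr
          exact ht.2
  exact abs_deriv_le_of_integral_sq hL (hux t ht) (huxx t ht) (hsl cuxx t ht) hM (hela t ht) hx
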